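/- Let (o_0,…,o_k) ∈ O^{k+1} be an observation sequence with Z = Σ_{w = (s_0,…,s_k) ∈ S^{k+1} : obs(s_i) = o_i for all i} W(w) > 0. Then the recursively defined belief states b^{(0)} = b_{o_0} and b^{(j+1)} = b^{(j)} ▷ o_{j+1} (for 0 ≤ j < k) are all well defined (every normalizing denominator is positive), and for every state s ∈ S, b^{(k)}(s) = (Σ_{w = (s_0,…,s_k) ∈ S^{k+1} : obs(s_i) = o_i for all i and s_k = s} W(w)) / Z. That is, the recursively computed belief state equals the conditional distribution of the current state given the observation history. -/

import Mathlib

/-- The weight of a finite path `w = (s_0,…,s_n)`: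
`W(w) = μ0(s_0) · ∏_{i=0}^{n-1} T(s_i, s_{i+1})`. -/
noncomputable def pathWeight {S : Type*} (μ0 : S → ℝ) (T : S → S → ℝ)
    {n : ℕ} (w : Fin (n + 1) → S) : ℝ :=
  μ0 (w 0) * ∏ i : Fin n, T (w i.castSucc) (w i.succ)

/-- The initial belief state for an observation `o`:
`b_o(s) = μ0(s) / Σ_{s' : obs(s') = o} μ0(s')` if `obs(s) = o`, and `0` otherwise. -/
noncomputable def initBelief {S O : Type*} [Fintype S] [DecidableEq O]
    (obs : S → O) (μ0 : S → ℝ) (o : O) : S → ℝ :=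
  fun s =>
    if obs s = o then μ0 s / ∑ s' ∈ Finset.univ.filter (fun s' => obs s' = o), μ0 s' else 0

/-- The Bayesian update `b ▷ o` of a belief vector `b` upon observing `o`:
`(b ▷ o)(s') = (Σ_s b(s)·T(s,s')) / (Σ_{s'' : obs(s'') = o} Σ_s b(s)·T(s,s''))`
if `obs(s') = o`, and `0` otherwise. -/
noncomputable def bayesUpdate {S O : Type*} [Fintype S] [DecidableEq O]
    (obs : S → O) (T : S → S → ℝ) (b : S → ℝ) (o : O) : S → ℝ :=
  fun s' =>
    if obs s' = o then
      (∑ s, b s * T s s') /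
        ∑ s'' ∈ Finset.univ.filter (fun s'' => obs s'' = o), ∑ s, b s * T s s''
    else 0

/-- The recursively defined belief states along an observation sequence `o`:
`b^{(0)} = b_{o_0}` and `b^{(j+1)} = b^{(j)} ▷ o_{j+1}`. -/
noncomputable def beliefSeq {S O : Type*} [Fintype S] [DecidableEq O]
    (obs : S → O) (μ0 : S → ℝ) (T : S → S → ℝ) (o : ℕ → O) : ℕ → S → ℝ
  | 0 => initBelief obs μ0 (o 0)
  | j + 1 => bayesUpdate obs T (beliefSeq obs μ0 T o j) (o (j + 1))

/-- The total weight of the paths of length `n` that produce the observations `o 0, …, o n`. -/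
noncomputable def obsWeight {S O : Type*} [Fintype S] [DecidableEq O]
    (obs : S → O) (μ0 : S → ℝ) (T : S → S → ℝ) (o : ℕ → O) (n : ℕ) : ℝ :=
  ∑ w ∈ Finset.univ.filter
      (fun w : Fin (n + 1) → S => ∀ i : Fin (n + 1), obs (w i) = o i.val),
    pathWeight μ0 T w

/-- The total weight of the paths of length `n` that produce the observations `o 0, …, o n`
and end in the state `s`. -/
noncomputable def obsEndWeight {S O : Type*} [Fintype S] [DecidableEq S] [DecidableEq O]
    (obs : S → O) (μ0 : S → ℝ) (T : S → S → ℝ) (o : ℕ → O) (n : ℕ) (s : S) : ℝ :=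
  ∑ w ∈ Finset.univ.filter (fun w : Fin (n + 1) → S =>
      (∀ i : Fin (n + 1), obs (w i) = o i.val) ∧ w (Fin.last n) = s),
    pathWeight μ0 T w

theorem pathWeight_snoc {S : Type*} (μ0 : S → ℝ) (T : S → S → ℝ) {n : ℕ}
    (w : Fin (n + 1) → S) (s : S) :
    pathWeight μ0 T (Fin.snoc w s : Fin (n + 2) → S) =
      pathWeight μ0 T w * T (w (Fin.last n)) s := by
  have h0 : (Fin.snoc w s : Fin (n + 2) → S) 0 = w 0 :=
    Fin.snoc_castSucc (α := fun _ => S) s w 0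
  simp only [pathWeight, h0, Fin.prod_univ_castSucc, Fin.snoc_castSucc, Fin.succ_last,
    Fin.snoc_last, ← Fin.castSucc_succ, mul_assoc]

section ForwardRecursion

variable {S O : Type*} [Fintype S] [DecidableEq S] [DecidableEq O]
  (obs : S → O) (μ0 : S → ℝ) (T : S → S → ℝ) (o : ℕ → O)

theorem sum_obsEndWeight (n : ℕ) :
    ∑ s, obsEndWeight obs μ0 T o n s = obsWeight obs μ0 T o n := by
  simp only [obsEndWeight, obsWeight, ← Finset.filter_filter]
  exact Finset.sum_fiberwise _ _ _

theorem obsEndWeight_zero (s : S) :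
    obsEndWeight obs μ0 T o 0 s = if obs s = o 0 then μ0 s else 0 := by
  rw [obsEndWeight, Finset.sum_filter,
    ← (Equiv.funUnique (Fin 1) S).symm.sum_comp, Finset.sum_eq_single s]
  · simp [pathWeight]
  · intro t _ hts
    simp [hts]
  · simp

theorem obsEndWeight_succ (n : ℕ) (s' : S) :
    obsEndWeight obs μ0 T o (n + 1) s' =
      if obs s' = o (n + 1) then ∑ s, obsEndWeight obs μ0 T o n s * T s s' else 0 := by
  have hstep : ∑ s, obsEndWeight obs μ0 T o n s * T s s' =
      ∑ w ∈ Finset.univ.filter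
          (fun w : Fin (n + 1) → S => ∀ i : Fin (n + 1), obs (w i) = o i.val),
        pathWeight μ0 T w * T (w (Fin.last n)) s' := by
    rw [← Finset.sum_fiberwise _ (fun w : Fin (n + 1) → S => w (Fin.last n))]
    refine Finset.sum_congr rfl fun s _ => ?_
    rw [obsEndWeight, Finset.sum_mul, Finset.filter_filter]
    refine Finset.sum_congr rfl fun w hw => ?_
    rw [(Finset.mem_filter.1 hw).2.2]
  rw [hstep, obsEndWeight, Finset.sum_filter,
    ← (Fin.snocEquiv fun _ : Fin (n + 2) => S).sum_comp, Fintype.sum_prod_type,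
    Finset.sum_eq_single s']
  · by_cases h : obs s' = o (n + 1)
    · simp [Fin.snocEquiv, Fin.forall_fin_succ', h, pathWeight_snoc, Finset.sum_filter]
    · simp [Fin.snocEquiv, Fin.forall_fin_succ', h]
  · intro t _ hts
    simp [Fin.snocEquiv, hts]
  · simp

theorem obsEndWeight_nonneg (hμ0 : ∀ s, 0 ≤ μ0 s) (hT : ∀ s s', 0 ≤ T s s') (n : ℕ) (s : S) :
    0 ≤ obsEndWeight obs μ0 T o n s :=
  Finset.sum_nonneg fun _ _ => mul_nonneg (hμ0 _) (Finset.prod_nonneg fun _ _ => hT _ _)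

theorem obsWeight_zero :
    obsWeight obs μ0 T o 0 = ∑ s ∈ Finset.univ.filter (fun s => obs s = o 0), μ0 s := by
  simp only [← sum_obsEndWeight, obsEndWeight_zero, Finset.sum_filter]

theorem obsWeight_succ (n : ℕ) :
    obsWeight obs μ0 T o (n + 1) =
      ∑ s' ∈ Finset.univ.filter (fun s' => obs s' = o (n + 1)),
        ∑ s, obsEndWeight obs μ0 T o n s * T s s' := by
  simp only [← sum_obsEndWeight, obsEndWeight_succ, Finset.sum_filter]

theorem obsWeight_antitone (hμ0 : ∀ s, 0 ≤ μ0 s) (hT : ∀ s s', 0 ≤ T s s')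
    (hTsum : ∀ s, ∑ s', T s s' = 1) : Antitone (obsWeight obs μ0 T o) := by
  refine antitone_nat_of_succ_le fun n => ?_
  calc obsWeight obs μ0 T o (n + 1)
      ≤ ∑ s', ∑ s, obsEndWeight obs μ0 T o n s * T s s' := by
        rw [obsWeight_succ]
        exact Finset.sum_le_sum_of_subset_of_nonneg (Finset.filter_subset _ _) fun _ _ _ =>
          Finset.sum_nonneg fun _ _ =>
            mul_nonneg (obsEndWeight_nonneg obs μ0 T o hμ0 hT n _) (hT _ _)
    _ = obsWeight obs μ0 T o n := by
        rw [Finset.sum_comm, ← sum_obsEndWeight]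
        simp only [← Finset.mul_sum, hTsum, mul_one]

theorem beliefSeq_eq_div (n : ℕ) (hpos : ∀ j ≤ n, 0 < obsWeight obs μ0 T o j) (s : S) :
    beliefSeq obs μ0 T o n s = obsEndWeight obs μ0 T o n s / obsWeight obs μ0 T o n := by
  induction n generalizing s with
  | zero => simp only [beliefSeq, initBelief, obsEndWeight_zero, obsWeight_zero, ite_div, zero_div]
  | succ n ih =>
    have ih' := ih fun j hj => hpos j (hj.trans n.le_succ)
    have hn := (hpos n n.le_succ).ne'
    simp only [beliefSeq, bayesUpdate, ih', div_mul_eq_mul_div, ← Finset.sum_div,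
      ← obsWeight_succ, obsEndWeight_succ, ite_div, zero_div, div_div_div_cancel_right₀ hn]

end ForwardRecursion

/-- Let `(o_0,…,o_k)` be an observation sequence with
`Z = Σ_{w = (s_0,…,s_k) : obs(s_i) = o_i for all i} W(w) > 0`.  Then the recursively
defined belief states `b^{(0)} = b_{o_0}` and `b^{(j+1)} = b^{(j)} ▷ o_{j+1}` are all well
defined (every normalizing denominator is positive), and for every state `s`,
`b^{(k)}(s) = (Σ_{w : obs-sequence (o_0,…,o_k) and s_k = s} W(w)) / Z`: the recursively
computed belief state equals the conditional distribution of the current state given the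
observation history. -/
theorem stmt6 {S O : Type*} [Fintype S] [Fintype O] [Nonempty S]
    [DecidableEq S] [DecidableEq O]
    (obs : S → O)
    (μ0 : S → ℝ) (hμ0 : ∀ s, 0 ≤ μ0 s) (hμ0sum : ∑ s, μ0 s = 1)
    (T : S → S → ℝ) (hT : ∀ s s', 0 ≤ T s s') (hTsum : ∀ s, ∑ s', T s s' = 1)
    (k : ℕ) (o : ℕ → O)
    (hZ : 0 < ∑ w ∈ Finset.univ.filter
        (fun w : Fin (k + 1) → S => ∀ i : Fin (k + 1), obs (w i) = o i.val),
      pathWeight μ0 T w) :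
    (0 < ∑ s ∈ Finset.univ.filter (fun s => obs s = o 0), μ0 s) ∧
    (∀ j < k, 0 < ∑ s'' ∈ Finset.univ.filter (fun s'' => obs s'' = o (j + 1)),
        ∑ s, beliefSeq obs μ0 T o j s * T s s'') ∧
    (∀ s : S, beliefSeq obs μ0 T o k s =
      (∑ w ∈ Finset.univ.filter (fun w : Fin (k + 1) → S =>
          (∀ i : Fin (k + 1), obs (w i) = o i.val) ∧ w (Fin.last k) = s),
        pathWeight μ0 T w) /
      (∑ w ∈ Finset.univ.filter
          (fun w : Fin (k + 1) → S => ∀ i : Fin (k + 1), obs (w i) = o i.val),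
        pathWeight μ0 T w)) := by
  have hpos : ∀ j ≤ k, 0 < obsWeight obs μ0 T o j := fun j hj =>
    lt_of_lt_of_le hZ (obsWeight_antitone obs μ0 T o hμ0 hT hTsum hj)
  refine ⟨?_, fun j hj => ?_, beliefSeq_eq_div obs μ0 T o k hpos⟩
  · rw [← obsWeight_zero obs μ0 T o]
    exact hpos 0 k.zero_le
  · simp only [beliefSeq_eq_div obs μ0 T o j fun i hi => hpos i (hi.trans hj.le),
      div_mul_eq_mul_div, ← Finset.sum_div, ← obsWeight_succ]
    exact div_pos (hpos (j + 1) hj) (hpos j hj.le)
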